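/- Let K be a field of characteristic 2, R = K[x,y,z], and let I be a 3-generated homogeneous ideal with minimal generators of the same degree, defining the radical ideal of a finite set of distinct points p_1,...,p_n ∈ P^2(K). Then I^(3) ⊆ I^2. -/

import Mathlib

open MvPolynomial

noncomputable section

/-- The ideal of `K[x₀,…]` generated by the homogeneous polynomials vanishing at
(a representative vector of) a point of projective space. -/
def pointIdeal {K : Type*} [Field K] {n : ℕ} (v : Fin n → K) :
    Ideal (MvPolynomial (Fin n) K) :=
  Ideal.span {f | (∃ d, f.IsHomogeneous d) ∧ eval v f = 0}

/-- `I` is the ideal of a finite nonempty set of distinct (reduced) points of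
projective space, given by nonzero, pairwise non-proportional representative
vectors `p 0, …, p n`. -/
def DefinesReducedPoints {K : Type*} [Field K] {N : ℕ}
    (I : Ideal (MvPolynomial (Fin (N + 1)) K)) : Prop :=
  ∃ (n : ℕ) (p : Fin (n + 1) → (Fin (N + 1) → K)),
    (∀ i, p i ≠ 0) ∧ (∀ i j, i ≠ j → ∀ t : K, p i ≠ t • p j) ∧
    I = ⨅ i, pointIdeal (p i)

/-- Coordinates of `S` over `R` along a ring homomorphism `f : R →+* S`: a spanning family of `S`
together with an additive choice of coordinates which is linear over `R` along `f`. -/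
structure CoordinatesAlong {R S : Type*} [CommRing R] [CommRing S] (f : R →+* S)
    (ι : Type*) where
  /-- The spanning family. -/
  vec : ι → S
  /-- The coordinates of an element. -/
  repr : S →+ (ι →₀ R)
  repr_mul : ∀ r s, repr (f r * s) = r • repr s
  sum_repr : ∀ s, (repr s).sum (fun i c => f c * vec i) = s

namespace CoordinatesAlong

variable {R S ι : Type*} [CommRing R] [CommRing S] {f : R →+* S}

theorem mem_map_iff (b : CoordinatesAlong f ι) (I : Ideal R) (s : S) :
    s ∈ I.map f ↔ ∀ i, b.repr s i ∈ I := by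
  constructor
  · intro hs i
    induction hs using Submodule.span_induction with
    | mem x hx =>
      obtain ⟨a, ha, rfl⟩ := hx
      rw [← mul_one (f a), b.repr_mul]
      exact I.mul_mem_right _ ha
    | zero => simp
    | add x y _ _ hx hy => simpa using I.add_mem hx hy
    | smul c x hx _ =>
      clear * - hx
      induction hx using Submodule.span_induction generalizing c with
      | mem x hx =>
        obtain ⟨a, ha, rfl⟩ := hx
        rw [smul_eq_mul, mul_comm, b.repr_mul]
        exact I.mul_mem_right _ ha
      | zero => simp
      | add x y _ _ hx hy => simpa [mul_add] using I.add_mem (hx c) (hy c)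
      | smul d x _ hx => simpa [mul_assoc] using hx (c * d)
  · intro h
    rw [← b.sum_repr s]
    exact Ideal.sum_mem _ fun i _ => Ideal.mul_mem_right _ _ (Ideal.mem_map_of_mem f (h i))

theorem map_iInf {κ : Sort*} (b : CoordinatesAlong f ι) (I : κ → Ideal R) :
    (⨅ k, I k).map f = ⨅ k, (I k).map f := by
  ext s
  simp only [Ideal.mem_iInf, b.mem_map_iff]
  exact forall_comm

/-- Coordinates of a field extension with respect to a basis. -/
def ofField {K L : Type*} [Field K] [Field L] (f : K →+* L) :
    letI := f.toAlgebra
    CoordinatesAlong f (Module.Basis.ofVectorSpaceIndex K L) :=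
  letI := f.toAlgebra
  let b := Module.Basis.ofVectorSpace K L
  { vec := b
    repr := b.repr.toLinearMap.toAddMonoidHom
    repr_mul := fun r s => b.repr.map_smul r s
    sum_repr := fun s => b.linearCombination_repr s }

/-- Coordinates of a polynomial ring along its Frobenius endomorphism, built out of coordinates
along the Frobenius endomorphism of the coefficients. -/
def mvPolynomial {A : Type*} [CommRing A] (p : ℕ) [Fact p.Prime] [CharP A p]
    (b : CoordinatesAlong (frobenius A p) ι) (σ : Type*) :
    CoordinatesAlong (frobenius (MvPolynomial σ A) p) ((σ →₀ ℕ) × ι) :=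
  let φ : (σ →₀ ℕ) → A →+ ((σ →₀ ℕ) × ι →₀ MvPolynomial σ A) := fun s =>
    (Finsupp.liftAddHom fun j =>
      (Finsupp.singleAddHom (s.mapRange (· % p) (Nat.zero_mod p), j)).comp
        (monomial (s.mapRange (· / p) (Nat.zero_div p))).toAddMonoidHom).comp b.repr
  let Φ : MvPolynomial σ A →+ ((σ →₀ ℕ) × ι →₀ MvPolynomial σ A) :=
    (Finsupp.liftAddHom φ).comp AddMonoidAlgebra.coeffAddEquiv.toAddMonoidHom
  have hΦ : ∀ s a, Φ (monomial s a) = φ s a := fun s a => by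
    simp only [Φ, AddMonoidHom.comp_apply, Finsupp.liftAddHom_apply]
    exact sum_monomial_eq (map_zero _)
  { vec := fun i => monomial i.1 (b.vec i.2)
    repr := Φ
    repr_mul := by
      intro r s
      induction r using MvPolynomial.induction_on' with
      | add r₁ r₂ h₁ h₂ => rw [map_add, add_mul, map_add, h₁, h₂, add_smul]
      | monomial u c =>
        induction s using MvPolynomial.induction_on' with
        | add s₁ s₂ h₁ h₂ => rw [mul_add, map_add, h₁, h₂, map_add, smul_add]
        | monomial v d =>
          have hm : (p • u + v).mapRange (· % p) (Nat.zero_mod p)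
              = v.mapRange (· % p) (Nat.zero_mod p) := by
            ext; simp
          have hd : (p • u + v).mapRange (· / p) (Nat.zero_div p)
              = u + v.mapRange (· / p) (Nat.zero_div p) := by
            ext; simp [Nat.mul_add_div (Fact.out : p.Prime).pos]
          rw [frobenius_def, monomial_pow, monomial_mul, hΦ, hΦ, ← frobenius_def]
          simp only [φ, AddMonoidHom.comp_apply, b.repr_mul, hm, hd]
          generalize b.repr d = x
          induction x using Finsupp.induction_linear with
          | zero => simp
          | add x y hx hy => rw [smul_add, map_add, map_add, smul_add, hx, hy]
          | single j a =>
            rw [Finsupp.smul_single]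
            simp only [Finsupp.liftAddHom_apply_single, AddMonoidHom.comp_apply,
              LinearMap.toAddMonoidHom_coe, Finsupp.singleAddHom_apply, Finsupp.smul_single,
              smul_eq_mul, monomial_mul]
    sum_repr := by
      intro s
      have hadd : ∀ x y : (σ →₀ ℕ) × ι →₀ MvPolynomial σ A,
          (x + y).sum (fun i c => frobenius _ p c * monomial i.1 (b.vec i.2)) =
          x.sum (fun i c => frobenius _ p c * monomial i.1 (b.vec i.2)) +
          y.sum (fun i c => frobenius _ p c * monomial i.1 (b.vec i.2)) := fun x y =>
        Finsupp.sum_add_index' (by simp) (by simp [add_mul])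
      induction s using MvPolynomial.induction_on' with
      | add s₁ s₂ h₁ h₂ => rw [map_add, hadd, h₁, h₂]
      | monomial v d =>
        have hv : p • v.mapRange (· / p) (Nat.zero_div p) + v.mapRange (· % p) (Nat.zero_mod p)
            = v := by
          ext; simp [Nat.div_add_mod]
        rw [hΦ]
        conv_rhs => rw [← b.sum_repr d]
        simp only [φ, AddMonoidHom.comp_apply]
        generalize b.repr d = x
        induction x using Finsupp.induction_linear with
        | zero => simp
        | add x y hx hy =>
          rw [map_add, hadd, hx, hy, Finsupp.sum_add_index' (by simp) (by simp [add_mul]),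
            map_add]
        | single j a =>
          rw [Finsupp.sum_single_index (by simp), Finsupp.liftAddHom_apply_single,
            AddMonoidHom.comp_apply, Finsupp.singleAddHom_apply,
            Finsupp.sum_single_index (by simp)]
          simp only [LinearMap.toAddMonoidHom_coe, frobenius_def, monomial_pow, monomial_mul, hv] }

end CoordinatesAlong

theorem MvPolynomial.IsHomogeneous.aeval_mul_algebraMap {R S σ : Type*} [CommRing R]
    [CommRing S] [Algebra R S] [Fintype σ] {f : MvPolynomial σ R} {d : ℕ} (hf : f.IsHomogeneous d)
    (t : S) (v : σ → R) :
    MvPolynomial.aeval (fun j => t * algebraMap R S (v j)) f =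
      t ^ d * algebraMap R S (MvPolynomial.eval v f) := by
  rw [aeval_def, eval₂_eq', eval_eq', map_sum, Finset.mul_sum]
  refine Finset.sum_congr rfl fun m hm => ?_
  have hd : ∑ i, m i = d := by
    rw [← hf (mem_support_iff.1 hm), Finsupp.weight_apply, Finsupp.sum_fintype _ _ (by simp)]
    simp
  simp only [mul_pow, Finset.prod_mul_distrib, Finset.prod_pow_eq_pow_sum, hd, map_mul, map_prod,
    map_pow]
  ring

/-- A homogeneous polynomial vanishing at `v` lies in the ideal of the linear forms
`v k * X j - v j * X k`. -/
theorem pointIdeal_le_span {K : Type*} [Field K] {n : ℕ} (v : Fin n → K) {k : Fin n}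
    (hk : v k ≠ 0) :
    pointIdeal v ≤ Ideal.span (Set.range fun j => C (v k) * X j - C (v j) * X k) := by
  set J : Ideal (MvPolynomial (Fin n) K) :=
    Ideal.span (Set.range fun j => C (v k) * X j - C (v j) * X k)
  refine Ideal.span_le.2 ?_
  rintro f ⟨⟨d, hd⟩, hf⟩
  refine Ideal.Quotient.eq_zero_iff_mem.1 ?_
  set q := Ideal.Quotient.mkₐ K J
  have hX : ∀ j, q (X j) = q (C (v k)⁻¹ * X k) * algebraMap K _ (v j) := by
    intro j
    have h : q (C (v k) * X j - C (v j) * X k) = 0 :=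
      Ideal.Quotient.eq_zero_iff_mem.2 (Ideal.subset_span ⟨j, rfl⟩)
    have h2 : X j = C (v k)⁻¹ * (C (v k) * X j - C (v j) * X k)
        + (C (v k)⁻¹ * X k) * algebraMap K (MvPolynomial (Fin n) K) (v j) := by
      have h3 : (C (v k)⁻¹ : MvPolynomial (Fin n) K) * C (v k) = 1 := by
        rw [← C_mul, inv_mul_cancel₀ hk, C_1]
      rw [algebraMap_eq]
      linear_combination -(X j) * h3
    conv_lhs => rw [h2]
    rw [map_add, map_mul, h, mul_zero, zero_add, map_mul, AlgHom.commutes]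
  change q f = 0
  rw [← aeval_X_left_apply f, comp_aeval_apply, funext hX, hd.aeval_mul_algebraMap, hf, map_zero,
    mul_zero]

theorem Ideal.span_pair_pow_three_le {R : Type*} [CommRing R] {J : Ideal R} {a b : R}
    (ha : a ^ 2 ∈ J) (hb : b ^ 2 ∈ J) : Ideal.span {a, b} ^ 3 ≤ J := by
  rw [pow_succ, pow_two, Ideal.span_pair_mul_span_pair, Ideal.span_mul_span', Ideal.span_le]
  rintro _ ⟨x, hx, y, hy, rfl⟩
  have haa := J.mul_mem_left a ha
  have hab := J.mul_mem_left b ha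
  have hba := J.mul_mem_left a hb
  have hbb := J.mul_mem_left b hb
  simp only [Set.mem_insert_iff, Set.mem_singleton_iff] at hx hy
  change x * y ∈ J
  rcases hx with rfl | rfl | rfl | rfl <;> rcases hy with rfl | rfl <;>
    first
    | (convert haa using 1; ring1)
    | (convert hab using 1; ring1)
    | (convert hba using 1; ring1)
    | (convert hbb using 1; ring1)

theorem pointIdeal_pow_three_le {K : Type*} [Field K] [CharP K 2] (v : Fin 3 → K) (hv : v ≠ 0) :
    pointIdeal v ^ 3 ≤ (pointIdeal v).map (frobenius (MvPolynomial (Fin 3) K) 2) := by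
  obtain ⟨k, hk⟩ := Function.ne_iff.1 hv
  have hl : ∀ j, C (v k) * X j - C (v j) * X k ∈ pointIdeal v := fun j =>
    Ideal.subset_span ⟨⟨1, ((isHomogeneous_X K j).C_mul _).sub ((isHomogeneous_X K k).C_mul _)⟩,
      by simp [mul_comm]⟩
  obtain ⟨a, b, ha, hb, hab⟩ : ∃ a b, a ∈ pointIdeal v ∧ b ∈ pointIdeal v ∧
      pointIdeal v ≤ Ideal.span {a, b} := by
    refine ⟨_, _, hl (k + 1), hl (k + 2), (pointIdeal_le_span v hk).trans (Ideal.span_le.2 ?_)⟩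
    rintro _ ⟨j, rfl⟩
    obtain rfl | rfl | rfl : j = k ∨ j = k + 1 ∨ j = k + 2 := by grind
    · simp
    · exact Ideal.subset_span (by simp)
    · exact Ideal.subset_span (by simp)
  exact (Ideal.pow_right_mono hab 3).trans <|
    Ideal.span_pair_pow_three_le (Ideal.mem_map_of_mem _ ha) (Ideal.mem_map_of_mem _ hb)

/-- in characteristic 2, `I⁽³⁾ ⊆ I²` holds for every 3-generated
homogeneous ideal `I`, with minimal generators of a common degree, defining the
radical ideal of a finite set of distinct points of `P²`. -/
theorem symbolic_cube_in_square_char_two {K : Type*} [Field K]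
    (hchar : ringChar K = 2) (n : ℕ) (p : Fin (n + 1) → (Fin 3 → K))
    (hp0 : ∀ i, p i ≠ 0)
    (hpdist : ∀ i j, i ≠ j → ∀ t : K, p i ≠ t • p j)
    (I : Ideal (MvPolynomial (Fin 3) K))
    (f g h : MvPolynomial (Fin 3) K) (d : ℕ)
    (hI : I = ⨅ i, pointIdeal (p i))
    (hgen : I = Ideal.span {f, g, h})
    (hminf : f ∉ Ideal.span {g, h}) (hming : g ∉ Ideal.span {f, h})
    (hminh : h ∉ Ideal.span {f, g})
    (hdf : f.IsHomogeneous d) (hdg : g.IsHomogeneous d)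
    (hdh : h.IsHomogeneous d) :
    (⨅ i, pointIdeal (p i) ^ 3) ≤ I ^ 2 := by
  have : CharP K 2 := hchar ▸ ringChar.charP K
  let b := (CoordinatesAlong.ofField (frobenius K 2)).mvPolynomial 2 (Fin 3)
  calc ⨅ i, pointIdeal (p i) ^ 3
      ≤ ⨅ i, (pointIdeal (p i)).map (frobenius (MvPolynomial (Fin 3) K) 2) :=
        iInf_mono fun i => pointIdeal_pow_three_le (p i) (hp0 i)
    _ = I.map (frobenius (MvPolynomial (Fin 3) K) 2) := by rw [hI, b.map_iInf]
    _ ≤ I ^ 2 := Ideal.map_le_iff_le_comap.2 fun a ha => Ideal.mem_comap.2 <| by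
      rw [frobenius_def]
      exact Ideal.pow_mem_pow ha 2

end
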